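/- As δ → 0⁺, Φ(δ) is asymptotic to δ^{-2}/log(1/δ), i.e. the ratio Φ(δ) / (δ^{-2}/log(1/δ)) tends to 1 as δ → 0⁺. -/

import Mathlib

open Finset Filter Real

/-- `ell k` is the product of the first `k` primes, `ℓ_k = p_1 ⋯ p_k`. -/
noncomputable def ell (k : ℕ) : ℕ := ∏ i ∈ Finset.range k, Nat.nth Nat.Prime i

/-- `Phi δ = ∑_{k=1}^∞ log(ℓ_k) · ℓ_k^{-δ}`. -/
noncomputable def Phi (δ : ℝ) : ℝ :=
  ∑' k : ℕ, Real.log (ell (k + 1)) * (ell (k + 1) : ℝ) ^ (-δ)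

open MeasureTheory Topology

theorem tendsto_log_nth_prime_div_log :
    Tendsto (fun n : ℕ => log (Nat.nth Nat.Prime n) / log ((n : ℝ) + 1)) atTop (𝓝 1) := by
  set p : ℕ → ℝ := fun n => (Nat.nth Nat.Prime n : ℝ)
  have hp_ge (n : ℕ) : (n : ℝ) + 2 ≤ p n := by
    simpa [p] using (Nat.cast_le (α := ℝ)).mpr (Nat.add_two_le_nth_prime n)
  have hp_top : Tendsto p atTop atTop :=
    tendsto_atTop_mono (fun n => by linarith [hp_ge n]) tendsto_natCast_atTop_atTop
  have hlogp : Tendsto (fun n => log (p n)) atTop atTop := tendsto_log_atTop.comp hp_top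
  have hcheb (n : ℕ) : p n * log 2 - log (p n + 1) ≤ ((n : ℝ) + 1) * log (p n) := by
    have h := (Chebyshev.psi_ge (Nat.nth Nat.Prime n)).trans
      (Chebyshev.psi_le_primeCounting_mul_log _)
    have hcount : Nat.primeCounting (Nat.nth Nat.Prime n) = n + 1 := by
      rw [Nat.primeCounting, Nat.primeCounting', Nat.count_succ, if_pos (Nat.prime_nth_prime n)]
      exact congrArg (· + 1) (Nat.primeCounting'_nth_eq n)
    rwa [hcount, Nat.cast_add_one] at h
  have hlin : ∀ᶠ n in atTop, p n / 3 ≤ ((n : ℝ) + 1) * log (p n) := by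
    have h := hp_top.eventually (isLittleO_log_id_atTop.def (c := 1 / 6) (by norm_num))
    filter_upwards [h, hp_top.eventually_ge_atTop 6] with n hn h6
    have h1 : log (p n + 1) ≤ log (p n) + 1 / p n := by
      have : p n + 1 = p n * (1 + 1 / p n) := by field_simp
      rw [this, log_mul (by positivity) (by positivity)]
      linarith [log_le_sub_one_of_pos (show 0 < 1 + 1 / p n by positivity)]
    have h2 : 1 / p n ≤ 1 / 6 := one_div_le_one_div_of_le (by norm_num) h6
    have h3 := le_of_abs_le hn
    simp only [id, norm_eq_abs, abs_of_nonneg (show 0 ≤ p n by linarith)] at h3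
    nlinarith [hcheb n, log_two_gt_d9]
  have hlower : ∀ᶠ n : ℕ in atTop,
      1 - (log 3 / log (p n) + log (log (p n)) / log (p n)) ≤ log ((n : ℝ) + 1) / log (p n) := by
    filter_upwards [hlin, hlogp.eventually_gt_atTop 0] with n hn h0
    have hp0 : 0 < p n := by linarith [hp_ge n, (Nat.cast_nonneg n : (0 : ℝ) ≤ n)]
    have h := log_le_log (by positivity) hn
    rw [log_div hp0.ne' (by norm_num), log_mul (by positivity) h0.ne'] at h
    rw [← add_div, one_sub_div h0.ne']
    gcongr
    linarith
  have hlim : Tendsto (fun n : ℕ => log ((n : ℝ) + 1) / log (p n)) atTop (𝓝 1) := by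
    refine tendsto_of_tendsto_of_tendsto_of_le_of_le' ?_ tendsto_const_nhds hlower ?_
    · have h1 : Tendsto (fun n => log 3 / log (p n)) atTop (𝓝 0) := hlogp.const_div_atTop _
      have h2 : Tendsto (fun n => log (log (p n)) / log (p n)) atTop (𝓝 0) :=
        isLittleO_log_id_atTop.tendsto_div_nhds_zero.comp hlogp
      simpa using (h1.add h2).const_sub 1
    · filter_upwards [hlogp.eventually_gt_atTop 0] with n h0
      exact div_le_one_of_le₀ (log_le_log (by positivity) (by linarith [hp_ge n])) h0.le
  simpa using hlim.inv₀ one_ne_zero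

theorem ell_pos (k : ℕ) : 0 < ell k :=
  Finset.prod_pos fun i _ => (Nat.prime_nth_prime i).pos

theorem factorial_le_ell (k : ℕ) : k.factorial ≤ ell k := by
  rw [← Finset.prod_range_add_one_eq_factorial, ell]
  exact Finset.prod_le_prod' fun i _ => by linarith [Nat.add_two_le_nth_prime i]

theorem ell_succ_le (n : ℕ) : ell (n + 1) ≤ Nat.nth Nat.Prime n ^ (n + 1) := by
  have h := Finset.prod_le_pow_card (Finset.range (n + 1)) (Nat.nth Nat.Prime)
    (Nat.nth Nat.Prime n) fun i hi =>
      Nat.nth_monotone Nat.infinite_setOfPred_prime (Finset.mem_range_succ_iff.mp hi)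
  simpa [ell] using h

theorem log_ell_nonneg (k : ℕ) : 0 ≤ log (ell k) := log_natCast_nonneg _

theorem tendsto_log_ell_succ_div :
    Tendsto (fun n : ℕ => log (ell (n + 1)) / (((n : ℝ) + 1) * log ((n : ℝ) + 1)))
      atTop (𝓝 1) := by
  have hlog : Tendsto (fun n : ℕ => log ((n : ℝ) + 1)) atTop atTop :=
    tendsto_log_atTop.comp (tendsto_atTop_add_const_right _ _ tendsto_natCast_atTop_atTop)
  refine tendsto_of_tendsto_of_tendsto_of_le_of_le' (g := fun n : ℕ => 1 - 1 / log ((n : ℝ) + 1))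
    ?_ tendsto_log_nth_prime_div_log ?_ ?_
  · simpa using (hlog.const_div_atTop 1).const_sub 1
  · filter_upwards [hlog.eventually_gt_atTop 0] with n h0
    have hfac : log ((n + 1).factorial) ≤ log (ell (n + 1)) :=
      log_le_log (mod_cast Nat.factorial_pos _) (mod_cast factorial_le_ell _)
    have hst := Stirling.le_log_factorial_stirling (Nat.succ_ne_zero n)
    push_cast [Nat.succ_eq_add_one] at hst
    have hpi : 0 ≤ log (2 * π) := log_nonneg (by linarith [pi_gt_three])
    rw [one_sub_div h0.ne', div_le_div_iff₀ h0 (by positivity)]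
    nlinarith
  · filter_upwards [hlog.eventually_gt_atTop 0] with n h0
    have h : log (ell (n + 1)) ≤ ((n : ℝ) + 1) * log (Nat.nth Nat.Prime n) := by
      have := log_le_log (mod_cast ell_pos (n + 1))
        (show (ell (n + 1) : ℝ) ≤ (Nat.nth Nat.Prime n : ℝ) ^ (n + 1) from
          mod_cast ell_succ_le n)
      rwa [log_pow, Nat.cast_add_one] at this
    rw [div_le_div_iff₀ (by positivity) h0]
    nlinarith

theorem tsum_eq_mul_integral_floor (g : ℕ → ℝ) {N : ℝ} (hN : 0 < N)
    (hg : IntegrableOn (fun x : ℝ => g ⌊x * N⌋₊) (Set.Ioi 0)) :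
    ∑' n, g n = N * ∫ x in Set.Ioi (0 : ℝ), g ⌊x * N⌋₊ := by
  have hmono : Monotone (fun n : ℕ => (n : ℝ) / N) := fun a b hab => by
    dsimp only
    gcongr
  have hunion : ⋃ n : ℕ, Set.Ico ((n : ℝ) / N) (((n + 1 : ℕ) : ℝ) / N) = Set.Ici 0 := by
    ext x
    simp only [Set.mem_iUnion, Set.mem_Ico, Set.mem_Ici, div_le_iff₀ hN, lt_div_iff₀ hN]
    constructor
    · rintro ⟨n, hn, -⟩
      exact nonneg_of_mul_nonneg_left ((Nat.cast_nonneg n).trans hn) hN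
    · intro hx
      exact ⟨⌊x * N⌋₊, Nat.floor_le (by positivity), mod_cast Nat.lt_floor_add_one _⟩
  have hpiece (n : ℕ) :
      ∫ x in Set.Ico ((n : ℝ) / N) (((n + 1 : ℕ) : ℝ) / N), g ⌊x * N⌋₊ = g n / N := by
    have hcongr : Set.EqOn (fun x : ℝ => g ⌊x * N⌋₊) (fun _ => g n)
        (Set.Ico ((n : ℝ) / N) (((n + 1 : ℕ) : ℝ) / N)) := by
      intro x hx
      rw [Set.mem_Ico, div_le_iff₀ hN, lt_div_iff₀ hN] at hx
      have : ⌊x * N⌋₊ = n :=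
        (Nat.floor_eq_iff ((Nat.cast_nonneg n).trans hx.1)).mpr ⟨hx.1, mod_cast hx.2⟩
      simp only [this]
    rw [setIntegral_congr_fun measurableSet_Ico hcongr, setIntegral_const,
      measureReal_def, Real.volume_Ico, ← sub_div, Nat.cast_succ, add_sub_cancel_left,
      ENNReal.toReal_ofReal (by positivity), smul_eq_mul]
    ring
  have h := hasSum_integral_iUnion (μ := volume) (f := fun x : ℝ => g ⌊x * N⌋₊)
    (s := fun n : ℕ => Set.Ico ((n : ℝ) / N) (((n + 1 : ℕ) : ℝ) / N))
    (fun _ => measurableSet_Ico) hmono.pairwise_disjoint_on_Ico_succ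
    (by rwa [hunion, integrableOn_Ici_iff_integrableOn_Ioi])
  rw [hunion, integral_Ici_eq_integral_Ioi] at h
  simp only [hpiece] at h
  rw [← h.tsum_eq, tsum_div_const]
  field_simp

theorem mul_exp_neg_le (y : ℝ) : y * exp (-y) ≤ 2 * exp (-(y / 2)) := by
  have h : y ≤ 2 * exp (y / 2) := by linarith [add_one_le_exp (y / 2)]
  calc y * exp (-y) ≤ 2 * exp (y / 2) * exp (-y) := by gcongr
    _ = 2 * exp (-(y / 2)) := by rw [mul_assoc, ← exp_add]; ring_nf

theorem integral_Ioi_mul_exp_neg : ∫ x in Set.Ioi (0 : ℝ), x * exp (-x) = 1 := by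
  have h := Gamma_eq_integral (s := 2) (by norm_num)
  rw [Gamma_two] at h
  rw [h]
  refine setIntegral_congr_fun measurableSet_Ioi fun x _ => ?_
  norm_num [mul_comm]

/-- The number of terms of `Phi δ` that matter is of order `termScale δ`. -/
noncomputable def termScale (δ : ℝ) : ℝ := 1 / (δ * log (1 / δ))

theorem tendsto_log_one_div : Tendsto (fun δ : ℝ => log (1 / δ)) (𝓝[>] 0) atTop := by
  simp only [one_div]
  exact tendsto_log_atTop.comp tendsto_inv_nhdsGT_zero

theorem log_termScale {δ : ℝ} (hδ : 0 < δ) (hL : 0 < log (1 / δ)) :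
    log (termScale δ) = log (1 / δ) - log (log (1 / δ)) := by
  rw [termScale, ← div_div, log_div (by positivity) hL.ne']

theorem tendsto_log_termScale_div :
    Tendsto (fun δ => log (termScale δ) / log (1 / δ)) (𝓝[>] 0) (𝓝 1) := by
  have h : Tendsto (fun δ : ℝ => log (log (1 / δ)) / log (1 / δ)) (𝓝[>] 0) (𝓝 0) :=
    isLittleO_log_id_atTop.tendsto_div_nhds_zero.comp tendsto_log_one_div
  have h1 := h.const_sub 1
  rw [sub_zero] at h1
  refine h1.congr' ?_
  filter_upwards [self_mem_nhdsWithin, tendsto_log_one_div.eventually_gt_atTop 0] with δ hδ hL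
  rw [log_termScale hδ hL, sub_div, div_self hL.ne']

theorem tendsto_termScale : Tendsto termScale (𝓝[>] 0) atTop := by
  have h : Tendsto (fun δ => log (termScale δ)) (𝓝[>] 0) atTop := by
    refine (tendsto_log_termScale_div.pos_mul_atTop one_pos tendsto_log_one_div).congr' ?_
    filter_upwards [tendsto_log_one_div.eventually_gt_atTop 0] with δ hL
    field_simp
  refine (tendsto_exp_atTop.comp h).congr' ?_
  filter_upwards [self_mem_nhdsWithin, tendsto_log_one_div.eventually_gt_atTop 0] with δ hδ hL
  have : 0 < δ := hδ
  exact exp_log (by unfold termScale; positivity)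

theorem tendsto_mul_log_ell_floor {x : ℝ} (hx : 0 < x) :
    Tendsto (fun δ => δ * log (ell (⌊x * termScale δ⌋₊ + 1))) (𝓝[>] 0) (𝓝 x) := by
  set m : ℝ → ℕ := fun δ => ⌊x * termScale δ⌋₊
  have hm : Tendsto m (𝓝[>] 0) atTop :=
    tendsto_nat_floor_atTop.comp (tendsto_termScale.const_mul_atTop hx)
  have hell := tendsto_log_ell_succ_div.comp hm
  have hratio : Tendsto (fun δ => ((m δ : ℝ) + 1) / termScale δ) (𝓝[>] 0) (𝓝 x) := by
    have h1 := (tendsto_nat_floor_mul_div_atTop hx.le).comp tendsto_termScale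
    have h2 := tendsto_termScale.const_div_atTop 1
    simpa [Function.comp_def, add_div, m] using h1.add h2
  have hlog : Tendsto (fun δ => log ((m δ : ℝ) + 1) / log (1 / δ)) (𝓝[>] 0) (𝓝 1) := by
    have h1 := (hratio.log hx.ne').div_atTop tendsto_log_one_div
    have h2 := h1.add tendsto_log_termScale_div
    rw [zero_add] at h2
    refine h2.congr' ?_
    filter_upwards [tendsto_termScale.eventually_gt_atTop 0] with δ hN
    rw [← add_div, log_div (by positivity) hN.ne', sub_add_cancel]
  have h := (hell.mul hratio).mul hlog
  simp only [one_mul, mul_one] at h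
  refine h.congr' ?_
  filter_upwards [self_mem_nhdsWithin, tendsto_log_one_div.eventually_gt_atTop 0,
    hm.eventually_ge_atTop 1] with δ hδ hL hm1
  have hδ' : δ ≠ 0 := ne_of_gt hδ
  have hlog0 : log ((m δ : ℝ) + 1) ≠ 0 :=
    (log_pos (by linarith [(Nat.one_le_cast (α := ℝ)).mpr hm1])).ne'
  have hm0 : (m δ : ℝ) + 1 ≠ 0 := by positivity
  have hscale : termScale δ = 1 / (δ * log (1 / δ)) := rfl
  change _ = δ * log (ell (m δ + 1))
  simp only [Function.comp_apply, hscale]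
  field_simp

theorem eventually_le_mul_log_ell_floor :
    ∀ᶠ δ in 𝓝[>] (0 : ℝ), ∀ x : ℝ, 1 ≤ x →
      x / 4 ≤ δ * log (ell (⌊x * termScale δ⌋₊ + 1)) := by
  obtain ⟨K, hK⟩ := eventually_atTop.mp
    (tendsto_log_ell_succ_div.eventually (eventually_ge_nhds (show (1 / 2 : ℝ) < 1 by norm_num)))
  filter_upwards [self_mem_nhdsWithin, tendsto_log_one_div.eventually_gt_atTop 0,
    tendsto_termScale.eventually_gt_atTop 1, tendsto_termScale.eventually_ge_atTop (K : ℝ),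
    tendsto_log_termScale_div.eventually (eventually_ge_nhds (show (1 / 2 : ℝ) < 1 by norm_num))]
    with δ hδ hL hN hNK hlogN x hx
  have hδ' : 0 < δ := hδ
  have hN0 : 0 < termScale δ := by linarith
  have hNx : termScale δ ≤ x * termScale δ := le_mul_of_one_le_left hN0.le hx
  have hmK : K ≤ ⌊x * termScale δ⌋₊ := Nat.le_floor (hNK.trans hNx)
  have hlt : x * termScale δ < (⌊x * termScale δ⌋₊ : ℝ) + 1 := Nat.lt_floor_add_one _
  have hell := hK _ hmK
  set M : ℝ := (⌊x * termScale δ⌋₊ : ℝ) + 1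
  have hlogM : log (termScale δ) ≤ log M := log_le_log hN0 (hNx.trans hlt.le)
  have hlogN0 : 0 < log (termScale δ) := log_pos hN
  rw [le_div_iff₀ (mul_pos (by linarith) (by linarith))] at hell
  rw [le_div_iff₀ hL] at hlogN
  calc x / 4 = δ * (1 / 2 * ((x * termScale δ) * (1 / 2 * log (1 / δ)))) := by
        unfold termScale
        field_simp
        norm_num
    _ ≤ δ * (1 / 2 * (M * log M)) := by
        gcongr
        exact hlogN.trans hlogM
    _ ≤ _ := by gcongr

/-- `Φ(δ) ~ δ⁻²/log(1/δ)` as `δ → 0⁺`. -/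
theorem Phi_asymptotics :
    Filter.Tendsto (fun δ : ℝ => Phi δ / (δ ^ (-2 : ℤ) / Real.log (1 / δ)))
      (nhdsWithin 0 (Set.Ioi 0)) (nhds 1) := by
  let y : ℝ → ℕ → ℝ := fun δ n => δ * log (ell (n + 1))
  let F : ℝ → ℝ → ℝ := fun δ x => y δ ⌊x * termScale δ⌋₊ * exp (-y δ ⌊x * termScale δ⌋₊)
  let bound : ℝ → ℝ := fun x => 2 * exp (1 / 8) * exp (-(1 / 8) * x)
  have hmeas (δ : ℝ) : AEStronglyMeasurable (F δ) (volume.restrict (Set.Ioi 0)) := by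
    have hy : Measurable fun x : ℝ => y δ ⌊x * termScale δ⌋₊ :=
      (measurable_from_nat (f := y δ)).comp
        (Nat.measurable_floor.comp (measurable_id.mul_const _))
    exact (hy.mul hy.neg.exp).aestronglyMeasurable
  have hbound_int : IntegrableOn bound (Set.Ioi 0) :=
    (integrableOn_exp_mul_Ioi (by norm_num) 0).const_mul _
  have hbound : ∀ᶠ δ in 𝓝[>] (0 : ℝ), ∀ᵐ x ∂volume.restrict (Set.Ioi 0), ‖F δ x‖ ≤ bound x := by
    filter_upwards [self_mem_nhdsWithin, eventually_le_mul_log_ell_floor] with δ hδ h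
    refine Eventually.of_forall fun x => ?_
    have hy0 : 0 ≤ y δ ⌊x * termScale δ⌋₊ := mul_nonneg (le_of_lt hδ) (log_ell_nonneg _)
    rw [norm_of_nonneg (by positivity)]
    refine (mul_exp_neg_le _).trans ?_
    simp only [bound, mul_assoc, ← exp_add]
    gcongr
    rcases le_total 1 x with hx | hx
    · linarith [h x hx]
    · linarith
  have hlim : Tendsto (fun δ => ∫ x in Set.Ioi (0 : ℝ), F δ x) (𝓝[>] 0) (𝓝 1) := by
    rw [← integral_Ioi_mul_exp_neg]
    refine tendsto_integral_filter_of_dominated_convergence bound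
      (Eventually.of_forall hmeas) hbound hbound_int ?_
    refine (ae_restrict_iff' measurableSet_Ioi).mpr (Eventually.of_forall fun x hx => ?_)
    have h := tendsto_mul_log_ell_floor hx
    exact h.mul ((continuous_exp.tendsto _).comp h.neg)
  refine hlim.congr' ?_
  filter_upwards [self_mem_nhdsWithin, hbound, tendsto_log_one_div.eventually_gt_atTop 0,
    tendsto_termScale.eventually_gt_atTop 0] with δ hδ hb hL hN
  have hδ' : δ ≠ 0 := ne_of_gt hδ
  have hPhi : δ * Phi δ = ∑' n, y δ n * exp (-y δ n) := by
    rw [Phi, ← tsum_mul_left]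
    refine tsum_congr fun n => ?_
    rw [rpow_def_of_pos (mod_cast ell_pos (n + 1))]
    simp only [y]
    ring_nf
  rw [tsum_eq_mul_integral_floor _ hN (hbound_int.mono' (hmeas δ) hb)] at hPhi
  change δ * Phi δ = termScale δ * ∫ x in Set.Ioi (0 : ℝ), F δ x at hPhi
  rw [eq_div_iff (by positivity), ← mul_right_inj' hδ', hPhi, termScale, zpow_neg]
  field_simp
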